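/- Let V be a finite-dimensional real vector space, B a nondegenerate alternating bilinear form on V, P : V → V self-adjoint with respect to B, and A the alternating form A(u, v) = B(Pu, v). Let α, β ∈ ℝ with β ≠ 0, suppose (P² − 2αP + (α² + β²)I)^n = 0 for some n ≥ 1, and let J be the semisimple part of the Jordan–Chevalley decomposition of (P − αI)/β, so J² = −I. Then every subspace U ⊆ V that is invariant under Aut(V, A, B) (i.e. Q(U) = U for every Q ∈ Aut(V, A, B)) is J-invariant: J(U) ⊆ U. -/

import Mathlib

/-- An operator on a vector space is semisimple if every invariant subspace has an
invariant complement. -/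
def IsSemisimpleOperator {K V : Type*} [Field K] [AddCommGroup V] [Module K V]
    (S : Module.End K V) : Prop :=
  ∀ U : Submodule K V, (∀ x ∈ U, S x ∈ U) →
    ∃ U' : Submodule K V, IsCompl U U' ∧ ∀ x ∈ U', S x ∈ U'

open Finset in
/-- The pairing `(v, w) ↦ ∑ B(N^(m-i) v, w) N^i` with values in polynomials in `N`. -/
noncomputable def powPairing {V : Type*} [AddCommGroup V] [Module ℝ V]
    (B : LinearMap.BilinForm ℝ V) (N : Module.End ℝ V) (m : ℕ) :
    V →ₗ[ℝ] V →ₗ[ℝ] Module.End ℝ V :=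
  LinearMap.mk₂ ℝ (fun v w => ∑ i ∈ range (m + 1), B ((N ^ (m - i)) v) w • N ^ i)
    (fun _ _ _ => by simp [add_smul, sum_add_distrib])
    (fun _ _ _ => by simp [mul_smul, smul_sum])
    (fun _ _ _ => by simp [add_smul, sum_add_distrib])
    (fun _ _ _ => by simp [mul_smul, smul_sum])

/-- The pairing with values in polynomials in `J` and `N` obtained from `powPairing` by
extending scalars along the complex structure `J`. -/
noncomputable def complexPairing {V : Type*} [AddCommGroup V] [Module ℝ V]
    (B : LinearMap.BilinForm ℝ V) (J N : Module.End ℝ V) (m : ℕ) (v w : V) : Module.End ℝ V :=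
  powPairing B N m v w - powPairing B N m (J v) w * J

section Pairing

variable {V : Type*} [AddCommGroup V] [Module ℝ V] {B : LinearMap.BilinForm ℝ V}
  {J N : Module.End ℝ V} {m : ℕ}

theorem powPairing_apply (v w : V) : powPairing B N m v w =
    ∑ i ∈ Finset.range (m + 1), B ((N ^ (m - i)) v) w • N ^ i := rfl

theorem selfAdjoint_pow (hN : ∀ u v, B (N u) v = B u (N v)) (k : ℕ) (u v : V) :
    B ((N ^ k) u) v = B u ((N ^ k) v) := by
  induction k generalizing u v with
  | zero => simp
  | succ k ih => rw [pow_succ, Module.End.mul_apply, ih, hN, ← Module.End.mul_apply,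
      ← pow_succ', pow_succ]

theorem powPairing_selfAdjoint {T : Module.End ℝ V} (hT : ∀ u v, B (T u) v = B u (T v))
    (hTN : Commute T N) (v w : V) : powPairing B N m (T v) w = powPairing B N m v (T w) := by
  simp only [powPairing_apply]
  refine Finset.sum_congr rfl fun i _ => ?_
  rw [← hT, ← Module.End.mul_apply, ← Module.End.mul_apply, (hTN.pow_right _).eq]

theorem powPairing_swap (hB : B.IsAlt) (hN : ∀ u v, B (N u) v = B u (N v)) (v w : V) :
    powPairing B N m v w = - powPairing B N m w v := by
  simp only [powPairing_apply, ← Finset.sum_neg_distrib]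
  refine Finset.sum_congr rfl fun i _ => ?_
  rw [selfAdjoint_pow hN, ← hB.neg_eq, neg_smul]

theorem powPairing_nilpotent_apply (hN : ∀ u v, B (N u) v = B u (N v)) (v : V) {w x : V}
    (hw : (N ^ (m + 1)) w = 0) (hx : (N ^ (m + 1)) x = 0) :
    powPairing B N m (N v) w x = N (powPairing B N m v w x) := by
  simp only [powPairing_apply, LinearMap.sum_apply, LinearMap.smul_apply, map_sum, map_smul,
    ← Module.End.mul_apply, ← pow_succ, ← pow_succ']
  rw [Finset.sum_range_succ', Finset.sum_range_succ (n := m)]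
  rw [Nat.sub_zero, selfAdjoint_pow hN (m + 1) v w, hw, hx]
  simp only [map_zero, zero_smul, smul_zero, add_zero]
  refine Finset.sum_congr rfl fun i hi => ?_
  rw [show m - (i + 1) + 1 = m - i by have := Finset.mem_range.1 hi; omega]

theorem commute_powPairing {T : Module.End ℝ V} (hTN : Commute T N) (v w : V) :
    Commute T (powPairing B N m v w) :=
  Commute.sum_right _ _ _ fun i _ => (hTN.pow_right i).smul_right _

theorem powPairing_adjoint (hB : B.IsAlt) (hN : ∀ u v, B (N u) v = B u (N v)) (v w x y : V) :
    B (powPairing B N m v w x) y = - B v (powPairing B N m y x w) := by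
  simp only [powPairing_apply, LinearMap.sum_apply, LinearMap.smul_apply, map_sum, map_smul,
    smul_eq_mul, ← Finset.sum_neg_distrib]
  rw [← Finset.sum_range_reflect]
  refine Finset.sum_congr rfl fun i hi => ?_
  have hi := Finset.mem_range.1 hi
  rw [show m - (m + 1 - 1 - i) = i by omega, show m + 1 - 1 - i = m - i by omega,
    selfAdjoint_pow hN i, selfAdjoint_pow hN (m - i), ← hB.neg_eq x]
  ring

theorem complexPairing_add_left (u v w : V) : complexPairing B J N m (u + v) w =
    complexPairing B J N m u w + complexPairing B J N m v w := by
  simp only [complexPairing, map_add, LinearMap.add_apply, add_mul]; abel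

theorem complexPairing_smul_left (c : ℝ) (v w : V) :
    complexPairing B J N m (c • v) w = c • complexPairing B J N m v w := by
  simp [complexPairing, smul_sub]

theorem complexPairing_complex (hJ2 : J * J = -1) (hJN : Commute J N) (v w : V) :
    complexPairing B J N m (J v) w = J * complexPairing B J N m v w := by
  have h : J (J v) = -v := by rw [← Module.End.mul_apply, hJ2]; simp
  have h1 := (commute_powPairing (B := B) (m := m) hJN v w).eq
  have h2 := (commute_powPairing (B := B) (m := m) hJN (J v) w).eq
  rw [complexPairing, complexPairing, h, mul_sub, ← mul_assoc, h1, h2, mul_assoc _ J J, hJ2]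
  simp [add_comm, sub_eq_add_neg]

theorem complexPairing_selfAdjoint {T : Module.End ℝ V} (hT : ∀ u v, B (T u) v = B u (T v))
    (hTN : Commute T N) (hTJ : Commute T J) (v w : V) :
    complexPairing B J N m (T v) w = complexPairing B J N m v (T w) := by
  rw [complexPairing, complexPairing, powPairing_selfAdjoint hT hTN,
    ← powPairing_selfAdjoint hT hTN (J v), ← Module.End.mul_apply, ← Module.End.mul_apply, hTJ.eq]

theorem complexPairing_swap (hB : B.IsAlt) (hN : ∀ u v, B (N u) v = B u (N v))
    (hJ : ∀ u v, B (J u) v = B u (J v)) (hJN : Commute J N) (v w : V) :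
    complexPairing B J N m v w = - complexPairing B J N m w v := by
  rw [complexPairing, complexPairing, powPairing_selfAdjoint hJ hJN, powPairing_swap hB hN,
    powPairing_swap hB hN v (J w)]
  simp [sub_eq_add_neg, add_comm]

theorem complexPairing_self (hB : B.IsAlt) (hN : ∀ u v, B (N u) v = B u (N v))
    (hJ : ∀ u v, B (J u) v = B u (J v)) (hJN : Commute J N) (v : V) :
    complexPairing B J N m v v = 0 := by
  have h := complexPairing_swap (m := m) hB hN hJ hJN v v
  refine (smul_eq_zero_iff_right (two_ne_zero (α := ℝ))).1 ?_
  rw [two_smul]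
  exact eq_neg_iff_add_eq_zero.1 h

theorem commute_complexPairing {T : Module.End ℝ V} (hTN : Commute T N) (hTJ : Commute T J)
    (v w : V) : Commute T (complexPairing B J N m v w) :=
  (commute_powPairing hTN v w).sub_right ((commute_powPairing hTN _ w).mul_right hTJ)

theorem complexPairing_nilpotent_apply (hN : ∀ u v, B (N u) v = B u (N v)) (hJN : Commute J N)
    (v : V) {w x : V} (hw : (N ^ (m + 1)) w = 0) (hx : (N ^ (m + 1)) x = 0) :
    complexPairing B J N m (N v) w x = N (complexPairing B J N m v w x) := by
  have hJx : (N ^ (m + 1)) (J x) = 0 := by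
    rw [← Module.End.mul_apply, ← (hJN.pow_right _).eq, Module.End.mul_apply, hx, map_zero]
  have h : J (N v) = N (J v) := by
    rw [← Module.End.mul_apply, hJN.eq, Module.End.mul_apply]
  simp only [complexPairing, LinearMap.sub_apply, Module.End.mul_apply, map_sub, h,
    powPairing_nilpotent_apply hN _ hw hx, powPairing_nilpotent_apply hN _ hw hJx]

theorem complexPairing_adjoint (hB : B.IsAlt) (hN : ∀ u v, B (N u) v = B u (N v))
    (hJ : ∀ u v, B (J u) v = B u (J v)) (hJN : Commute J N) (v w x y : V) :
    B (complexPairing B J N m v w x) y = - B v (complexPairing B J N m y x w) := by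
  have h1 := (commute_powPairing (B := B) (m := m) hJN (J y) x).eq
  simp only [complexPairing, LinearMap.sub_apply, map_sub, powPairing_adjoint hB hN]
  rw [← h1, Module.End.mul_apply, Module.End.mul_apply, powPairing_adjoint hB hN, hJ,
    ← powPairing_selfAdjoint hJ hJN]
  ring

/-- For `w` in the kernel of `N ^ (m + 1)`, pairing is linear in `w` over polynomials in `J`
and `N`, in particular over the values of the pairing itself. -/
theorem complexPairing_complexPairing_apply (hN : ∀ u v, B (N u) v = B u (N v))
    (hJ : ∀ u v, B (J u) v = B u (J v)) (hJ2 : J * J = -1) (hJN : Commute J N)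
    (u v e : V) {w x : V} (hw : (N ^ (m + 1)) w = 0) (hx : (N ^ (m + 1)) x = 0) :
    complexPairing B J N m e (complexPairing B J N m u v w) x =
      complexPairing B J N m u v (complexPairing B J N m e w x) := by
  let L : V →ₗ[ℝ] V :=
    { toFun := fun w => complexPairing B J N m e w x
      map_add' := fun a b => by
        simp only [complexPairing, map_add, add_mul, LinearMap.sub_apply, LinearMap.add_apply]; abel
      map_smul' := fun c a => by
        simp [complexPairing, smul_sub] }
  have hLJ (y : V) : L (J y) = J (L y) := by
    change complexPairing B J N m e (J y) x = J (complexPairing B J N m e y x)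
    rw [← complexPairing_selfAdjoint hJ hJN (Commute.refl J), complexPairing_complex hJ2 hJN]
    rfl
  have hLN (y : V) (hy : (N ^ (m + 1)) y = 0) : L (N y) = N (L y) := by
    change complexPairing B J N m e (N y) x = N (complexPairing B J N m e y x)
    rw [← complexPairing_selfAdjoint hN (Commute.refl N) hJN.symm,
      complexPairing_nilpotent_apply hN hJN e hy hx]
  have hLpow (i : ℕ) : ∀ y, (N ^ (m + 1)) y = 0 → L ((N ^ i) y) = (N ^ i) (L y) := by
    induction i with
    | zero => simp
    | succ i ih =>
      intro y hy
      have hNy : (N ^ (m + 1)) (N y) = 0 := by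
        rw [← Module.End.mul_apply, ← pow_succ, pow_succ', Module.End.mul_apply, hy, map_zero]
      rw [pow_succ, Module.End.mul_apply, ih _ hNy, hLN y hy, Module.End.mul_apply]
  have hLp (a b y : V) (hy : (N ^ (m + 1)) y = 0) :
      L (powPairing B N m a b y) = powPairing B N m a b (L y) := by
    simp only [powPairing_apply, LinearMap.sum_apply, LinearMap.smul_apply, map_sum, map_smul,
      hLpow _ y hy]
  have hJw : (N ^ (m + 1)) (J w) = 0 := by
    rw [← Module.End.mul_apply, ← (hJN.pow_right _).eq, Module.End.mul_apply, hw, map_zero]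
  change L (complexPairing B J N m u v w) = complexPairing B J N m u v (L w)
  simp only [complexPairing, LinearMap.sub_apply, Module.End.mul_apply, map_sub,
    hLp _ _ w hw, hLp _ _ _ hJw, hLJ]

theorem isUnit_complexPairing (hN : IsNilpotent N) (hJ2 : J * J = -1) (hJN : Commute J N)
    {e f : V} (hef : B ((N ^ m) e) f ≠ 0) : IsUnit (complexPairing B J N m e f) := by
  have hp (v w : V) : ∃ K : Module.End ℝ V, Commute N K ∧
      powPairing B N m v w = B ((N ^ m) v) w • 1 + N * K := by
    refine ⟨∑ i ∈ Finset.range m, B ((N ^ (m - (i + 1))) v) w • N ^ i,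
      Commute.sum_right _ _ _ fun i _ => ((Commute.refl N).pow_right i).smul_right _, ?_⟩
    rw [powPairing_apply, Finset.sum_range_succ', add_comm, Finset.mul_sum]
    simp [pow_succ']
  obtain ⟨K, hK, hKe⟩ := hp e f
  obtain ⟨L, hL, hLe⟩ := hp (J e) f
  set a := B ((N ^ m) e) f
  set b := B ((N ^ m) (J e)) f
  have hG : complexPairing B J N m e f = N * (K - L * J) + (a • 1 - b • J) := by
    rw [complexPairing, hKe, hLe, add_mul, mul_sub, mul_assoc, smul_mul_assoc, one_mul]; abel
  have hab : a ^ 2 + b ^ 2 ≠ 0 := by positivity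
  have hJab : (a • 1 - b • J) * (a • 1 + b • J) = (a ^ 2 + b ^ 2) • (1 : Module.End ℝ V) := by
    simp only [sub_mul, mul_add, smul_mul_smul_comm, hJ2, one_mul, mul_one]
    module
  have hJab' : (a • 1 + b • J) * (a • 1 - b • J) = (a ^ 2 + b ^ 2) • (1 : Module.End ℝ V) := by
    simp only [mul_sub, add_mul, smul_mul_smul_comm, hJ2, one_mul, mul_one]
    module
  have hu : IsUnit (a • 1 - b • J) :=
    ⟨⟨_, (a ^ 2 + b ^ 2)⁻¹ • (a • 1 + b • J), by
      rw [mul_smul_comm, hJab, smul_smul, inv_mul_cancel₀ hab, one_smul], by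
      rw [smul_mul_assoc, hJab', smul_smul, inv_mul_cancel₀ hab, one_smul]⟩, rfl⟩
  have hNKL : Commute N (K - L * J) := hK.sub_right (hL.mul_right hJN.symm)
  have hcG : Commute J (complexPairing B J N m e f) :=
    commute_complexPairing hJN (Commute.refl J) e f
  have hcJ : Commute J (N * (K - L * J)) := by
    have : N * (K - L * J) = complexPairing B J N m e f - (a • 1 - b • J) := by rw [hG]; abel
    rw [this]
    exact hcG.sub_right (((Commute.one_right J).smul_right a).sub_right
      ((Commute.refl J).smul_right b))
  rw [hG]
  refine (hNKL.isNilpotent_mul_right hN).isUnit_add_right_of_commute hu ?_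
  exact (((Commute.one_right _).smul_right a).sub_right (hcJ.symm.smul_right b))

end Pairing

/-- The semisimple part of a self-adjoint operator `J + N` with `J² = -1` is self-adjoint. -/
theorem selfAdjoint_of_selfAdjoint_add_nilpotent {V : Type*} [AddCommGroup V] [Module ℝ V]
    {B : LinearMap.BilinForm ℝ V} {J : Module.End ℝ V} (hJ2 : J * J = -1) (m : ℕ) :
    ∀ {N : Module.End ℝ V}, Commute J N → N ^ (2 ^ m) = 0 →
      (∀ u v, B ((J + N) u) v = B u ((J + N) v)) → ∀ u v, B (J u) v = B u (J v) := by
  induction m with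
  | zero =>
    intro N _ hN h
    obtain rfl : N = 0 := by simpa using hN
    simpa using h
  | succ m ih =>
    intro N hJN hN h
    -- Newton step for the equation `T² = -1`
    have hstep : J + (2⁻¹ : ℝ) • (N ^ 2 * ((3 : ℝ) • J + N)) =
        (2⁻¹ : ℝ) • ((3 : ℝ) • (J + N) + (J + N) ^ 3) := by
      have h2 : J * N = N * J := hJN
      have e : (J + N) ^ 3 = -J - 3 • N + 3 • (N ^ 2 * J) + N ^ 3 := by
        have h3 : J * N * J = -N := by rw [h2, mul_assoc, hJ2]; simp
        have h4 : J * (N * N) = N * N * J := by rw [← mul_assoc, h2, mul_assoc, h2, mul_assoc]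
        have h5 : N * J * J = -N := by rw [mul_assoc, hJ2]; simp
        simp only [pow_succ, pow_zero, one_mul, add_mul, mul_add, hJ2, h2, h5]
        rw [mul_assoc N J N, h2, ← mul_assoc]
        simp only [neg_mul, one_mul]
        abel
      rw [e, mul_add, mul_smul_comm, ← pow_succ]
      module
    refine ih (N := (2⁻¹ : ℝ) • (N ^ 2 * ((3 : ℝ) • J + N))) ?_ ?_ ?_
    · exact ((hJN.pow_right 2).mul_right
        (((Commute.refl J).smul_right (3 : ℝ)).add_right hJN)).smul_right _
    · have hc : Commute (N ^ 2) ((3 : ℝ) • J + N) :=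
        ((hJN.symm.smul_right (3 : ℝ)).add_right (Commute.refl N)).pow_left 2
      rw [smul_pow, hc.mul_pow, ← pow_mul, ← pow_succ', hN, zero_mul, smul_zero]
    · rw [hstep]
      generalize J + N = T at h
      intro u v
      simp only [LinearMap.smul_apply, LinearMap.add_apply, map_smul, map_add,
        selfAdjoint_pow h 3, h]

/-- A self-adjoint idempotent commuting with `J` and `N` is the square of a skew-adjoint
operator commuting with `J` and `N`. -/
theorem exists_skewAdjoint_sq_eq {V : Type*} [AddCommGroup V] [Module ℝ V]
    [FiniteDimensional ℝ V] {B : LinearMap.BilinForm ℝ V} (hB : B.IsAlt)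
    (hBnd : ∀ u : V, (∀ v : V, B u v = 0) → u = 0) {J N : Module.End ℝ V}
    (hN : ∀ u v, B (N u) v = B u (N v)) (hJ : ∀ u v, B (J u) v = B u (J v))
    (hJ2 : J * J = -1) (hJN : Commute J N) (hnil : IsNilpotent N)
    (F : Module.End ℝ V) (hFF : F * F = F) (hF : ∀ u v, B (F u) v = B u (F v))
    (hFJ : Commute F J) (hFN : Commute F N) :
    ∃ X : Module.End ℝ V, (∀ u v, B (X u) v = - B u (X v)) ∧ Commute X J ∧ Commute X N ∧
      X * X = F ∧ F * X = X := by
  induction hd : Module.finrank ℝ (LinearMap.range F) using Nat.strong_induction_on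
    generalizing F with
  | _ d ih =>
  by_cases hF0 : F = 0
  · exact ⟨0, by simp, Commute.zero_left _, Commute.zero_left _, by simp [hF0], by simp⟩
  obtain ⟨m, hm, hm1⟩ : ∃ m, N ^ m * F ≠ 0 ∧ N ^ (m + 1) * F = 0 := by
    classical
    have hex : ∃ k, N ^ k * F = 0 := hnil.imp fun k hk => by rw [hk, zero_mul]
    have hpos : Nat.find hex ≠ 0 := fun h => hF0 (by simpa [h] using Nat.find_spec hex)
    obtain ⟨m, hm⟩ := Nat.exists_eq_succ_of_ne_zero hpos
    exact ⟨m, Nat.find_min hex (by omega), by simpa [hm] using Nat.find_spec hex⟩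
  have hker {x : V} (hx : F x = x) : (N ^ (m + 1)) x = 0 := by
    rw [← hx, ← Module.End.mul_apply, hm1, LinearMap.zero_apply]
  have hFidem (x : V) : F (F x) = F x := by rw [← Module.End.mul_apply, hFF]
  obtain ⟨e₀, he₀⟩ : ∃ v, (N ^ m * F) v ≠ 0 := by
    by_contra! h
    exact hm (LinearMap.ext h)
  obtain ⟨e, hFe, hNe⟩ : ∃ e, F e = e ∧ (N ^ m) e ≠ 0 := ⟨F e₀, hFidem e₀, he₀⟩
  obtain ⟨f₀, hf₀⟩ : ∃ f, B ((N ^ m) e) f ≠ 0 := by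
    by_contra! h
    exact hNe (hBnd _ h)
  let G := complexPairing B J N m e (F f₀)
  have hG : IsUnit G := by
    refine isUnit_complexPairing hnil hJ2 hJN ?_
    rwa [← hF, ← Module.End.mul_apply, (hFN.pow_right m).eq, Module.End.mul_apply, hFe]
  obtain ⟨D, hDG⟩ : ∃ D, G * D = 1 := hG.exists_right_inv
  have hinj {x y : V} (h : G x = G y) : x = y := by
    obtain ⟨E, hE⟩ := hG.exists_left_inv
    simpa [← Module.End.mul_apply, hE] using congrArg E h
  have hGD (x : V) : G (D x) = x := by rw [← Module.End.mul_apply, hDG]; rfl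
  have hFG (x : V) : F (G x) = G (F x) := by
    rw [← Module.End.mul_apply, (commute_complexPairing hFN hFJ e (F f₀)).eq]; rfl
  let f := D (F f₀)
  have hFf : F f = f := hinj (by rw [← hFG, hGD, hFidem])
  have hef {x : V} (hx : F x = x) : complexPairing B J N m e f x = x := by
    apply hinj
    rw [← complexPairing_complexPairing_apply hN hJ hJ2 hJN e (F f₀) e (hker hFf) (hker hx)]
    change complexPairing B J N m e (G f) x = complexPairing B J N m e (F f₀) x
    rw [hGD]
  let X : Module.End ℝ V :=
    { toFun := fun v => complexPairing B J N m v f e + complexPairing B J N m v e f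
      map_add' := fun a b => by
        simp only [complexPairing_add_left, LinearMap.add_apply]; abel
      map_smul' := fun c a => by
        simp [complexPairing_smul_left] }
  have hX (v : V) : X v = complexPairing B J N m v f e + complexPairing B J N m v e f := rfl
  have hXskew (u v : V) : B (X u) v = - B u (X v) := by
    simp only [hX, map_add, LinearMap.add_apply, complexPairing_adjoint hB hN hJ hJN u]
    ring
  have hXJ : Commute X J := LinearMap.ext fun v => by
    simp [hX, complexPairing_complex hJ2 hJN]
  have hXN : Commute X N := LinearMap.ext fun v => by
    simp [hX, complexPairing_nilpotent_apply hN hJN _ (hker hFe) (hker hFf),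
      complexPairing_nilpotent_apply hN hJN _ (hker hFf) (hker hFe)]
  have hFX : F * X = X := LinearMap.ext fun v => by
    have h (a b x : V) : F (complexPairing B J N m a b x) = complexPairing B J N m a b (F x) := by
      rw [← Module.End.mul_apply, (commute_complexPairing hFN hFJ a b).eq]; rfl
    rw [Module.End.mul_apply, hX, map_add, h, h, hFe, hFf]
  have hXF : X * F = X := by
    refine LinearMap.ext fun v => ?_
    rw [Module.End.mul_apply, hX, hX, complexPairing_selfAdjoint hF hFN hFJ,
      complexPairing_selfAdjoint hF hFN hFJ, hFe, hFf]
  have hXe : X e = e := by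
    rw [hX, hef hFe, complexPairing_self hB hN hJ hJN, LinearMap.zero_apply, add_zero]
  have hXf : X f = -f := by
    rw [hX, complexPairing_self hB hN hJ hJN, complexPairing_swap hB hN hJ hJN f e,
      LinearMap.neg_apply, hef hFf, LinearMap.zero_apply, zero_add]
  have hXc (a b x : V) : X (complexPairing B J N m a b x) = complexPairing B J N m a b (X x) := by
    rw [← Module.End.mul_apply, (commute_complexPairing hXN hXJ a b).eq]; rfl
  have hX3 : X * (X * X) = X := LinearMap.ext fun v => by
    simp only [Module.End.mul_apply]
    rw [hX v]
    simp [hXc, hXe, hXf]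
  have hX4 : X * X * (X * X) = X * X := by rw [mul_assoc, hX3]
  have hX3' : X * X * X = X := by rw [mul_assoc, hX3]
  have hFXX : F * (X * X) = X * X := by rw [← mul_assoc, hFX]
  have hXXF : X * X * F = X * X := by rw [mul_assoc, hXF]
  have hXX (u v : V) : B ((X * X) u) v = B u ((X * X) v) := by
    simp [hXskew]
  have hlt : Module.finrank ℝ (LinearMap.range (F - X * X)) < d := by
    rw [← hd]
    refine Submodule.finrank_lt_finrank_of_lt (SetLike.lt_iff_le_and_exists.2 ⟨?_, e,
      LinearMap.mem_range.2 ⟨e, hFe⟩, ?_⟩)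
    · rintro _ ⟨v, rfl⟩
      exact ⟨(F - X * X) v, by rw [← Module.End.mul_apply, mul_sub, hFF, hFXX]⟩
    · rintro ⟨v, hv⟩
      have h0 : (F - X * X) e = 0 := by simp [hFe, hXe]
      have h1 : F e - (X * X) e = e := by
        rw [← LinearMap.sub_apply, ← hv, ← Module.End.mul_apply]
        congr 1
        rw [sub_mul, mul_sub, mul_sub, hFF, hFXX, hXXF, hX4, sub_self, sub_zero]
      rw [LinearMap.sub_apply, h1] at h0
      exact hNe (by rw [h0, map_zero])
  obtain ⟨Y, hYskew, hYJ, hYN, hYY, hFY⟩ := ih _ hlt (F - X * X)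
    (by rw [sub_mul, mul_sub, mul_sub, hFF, hFXX, hXXF, hX4, sub_self, sub_zero])
    (fun u v => by rw [LinearMap.sub_apply, LinearMap.sub_apply, map_sub, map_sub,
      LinearMap.sub_apply, hF, hXX])
    (hFJ.sub_left (hXJ.mul_left hXJ)) (hFN.sub_left (hXN.mul_left hXN)) rfl
  have hXY : X * Y = 0 := by
    rw [← hFY, ← mul_assoc, mul_sub, hXF, hX3, sub_self, zero_mul]
  have hYX : Y * X = 0 := by
    have hYF : Y * (F - X * X) = Y := by
      rw [← hYY, ← mul_assoc, hYY, hFY]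
    rw [← hYF, mul_assoc, sub_mul, hFX, hX3', sub_self, mul_zero]
  refine ⟨X + Y, fun u v => ?_, hXJ.add_left hYJ, hXN.add_left hYN, ?_, ?_⟩
  · simp only [LinearMap.add_apply, map_add, hXskew, hYskew]; ring
  · rw [add_mul, mul_add, mul_add, hXY, hYX, hYY]; abel
  · have hFY' : F * Y = Y := by
      rw [← hFY, ← mul_assoc, mul_sub, hFF, hFXX]
    rw [mul_add, hFX, hFY']


/-- Let `(V, B)` be a real symplectic space, `P` a `B`-self-adjoint operator with the single
pair of complex conjugate eigenvalues `α ± iβ` (`β ≠ 0`), `A(u,v) = B(Pu, v)`, and `J` the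
semisimple part of the Jordan–Chevalley decomposition of `(P − αI)/β` (so `J² = −I`). Then
every subspace `U` invariant under `Aut(V, A, B)` is `J`-invariant. -/
theorem invariant_subspace_is_J_invariant
    (V : Type*) [AddCommGroup V] [Module ℝ V] [FiniteDimensional ℝ V]
    (B : LinearMap.BilinForm ℝ V) (hBalt : B.IsAlt)
    (hBnd : ∀ u : V, (∀ v : V, B u v = 0) → u = 0)
    (P : Module.End ℝ V) (hP : ∀ u v : V, B (P u) v = B u (P v))
    (α β : ℝ) (hβ : β ≠ 0) (n : ℕ) (hn : 1 ≤ n)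
    (hchar : (P ^ 2 - (2 * α) • P + (α ^ 2 + β ^ 2) • (1 : Module.End ℝ V)) ^ n = 0)
    (J Nn : Module.End ℝ V) (hJss : IsSemisimpleOperator J) (hNn : IsNilpotent Nn)
    (hcomm : J * Nn = Nn * J)
    (hsum : β⁻¹ • (P - α • (1 : Module.End ℝ V)) = J + Nn)
    (hJ : J ^ 2 = -1)
    (U : Submodule ℝ V)
    (hU : ∀ Q : V ≃ₗ[ℝ] V, (∀ u v : V, B (P (Q u)) (Q v) = B (P u) v) →
      (∀ u v : V, B (Q u) (Q v) = B u v) → U.map (Q : V →ₗ[ℝ] V) = U) :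
    ∀ u ∈ U, J u ∈ U := by
  have hJ2 : J * J = -1 := by rw [← sq, hJ]
  have hPeq : P = α • (1 : Module.End ℝ V) + β • (J + Nn) := by
    rw [← hsum, smul_smul, mul_inv_cancel₀ hβ, one_smul]; abel
  have hT (u v : V) : B ((J + Nn) u) v = B u ((J + Nn) v) := by
    simp only [← hsum, LinearMap.smul_apply, LinearMap.sub_apply, map_smul, map_sub,
      Module.End.one_apply, hP]
  have hJadj : ∀ u v, B (J u) v = B u (J v) := by
    obtain ⟨k, hk⟩ := hNn
    exact selfAdjoint_of_selfAdjoint_add_nilpotent hJ2 k hcomm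
      (pow_eq_zero_of_le Nat.lt_two_pow_self.le hk) hT
  have hNadj (u v : V) : B (Nn u) v = B u (Nn v) := by
    simpa [hJadj] using hT u v
  obtain ⟨X, hX, hXJ, hXN, hXX, -⟩ := exists_skewAdjoint_sq_eq hBalt hBnd hNadj hJadj hJ2 hcomm hNn
    1 (one_mul 1) (fun _ _ => rfl) (Commute.one_left _) (Commute.one_left _)
  have hUinv (Q R : Module.End ℝ V) (hQR : Q * R = 1) (hRQ : R * Q = 1)
      (hQ : ∀ u v, B (Q u) v = B u (R v)) (hQP : Commute Q P) (u : V) (hu : u ∈ U) : Q u ∈ U := by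
    have hRQ' (v : V) : R (Q v) = v := by rw [← Module.End.mul_apply, hRQ]; rfl
    have hmap := hU (LinearEquiv.ofLinearMap Q R hQR hRQ)
      (fun u v => by
        change B (P (Q u)) (Q v) = B (P u) v
        rw [← Module.End.mul_apply, ← hQP.eq, Module.End.mul_apply, hQ, hRQ'])
      (fun u v => by
        change B (Q u) (Q v) = B u v
        rw [hQ, hRQ'])
    rw [← hmap]
    exact ⟨u, hu, rfl⟩
  have hcommP {T : Module.End ℝ V} (h₁ : Commute T J) (h₂ : Commute T Nn) : Commute T P := by
    rw [hPeq]
    exact ((Commute.one_right T).smul_right α).add_right ((h₁.add_right h₂).smul_right β)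
  have hYY : X * J * (X * J) = -1 := by
    rw [mul_assoc, ← mul_assoc J, ← hXJ.eq, mul_assoc, ← mul_assoc, hXX, one_mul, hJ2]
  have hXJU : ∀ u ∈ U, (X * J) u ∈ U := by
    refine hUinv (X * J) (-(X * J)) (by rw [mul_neg, hYY, neg_neg])
      (by rw [neg_mul, hYY, neg_neg]) (fun u v => ?_)
      (hcommP (hXJ.mul_left (Commute.refl J)) (hXN.mul_left hcomm))
    rw [Module.End.mul_apply, hX, hJadj, LinearMap.neg_apply, map_neg, hXJ.eq, Module.End.mul_apply]
  have hXU : ∀ u ∈ U, X u ∈ U := by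
    intro u hu
    have hmem := hUinv ((5 / 4 : ℝ) • 1 + (3 / 4 : ℝ) • X) ((5 / 4 : ℝ) • 1 - (3 / 4 : ℝ) • X)
      (by simp only [mul_sub, add_mul, smul_mul_smul_comm, hXX, one_mul, mul_one]; module)
      (by simp only [sub_mul, mul_add, smul_mul_smul_comm, hXX, one_mul, mul_one]; module)
      (fun u v => by simp [hX, sub_eq_add_neg])
      (hcommP (((Commute.one_left J).smul_left _).add_left (hXJ.smul_left _))
        (((Commute.one_left Nn).smul_left _).add_left (hXN.smul_left _))) u hu
    have h : X u = (4 / 3 : ℝ) • (((5 / 4 : ℝ) • (1 : Module.End ℝ V) + (3 / 4 : ℝ) • X) u)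
        - (5 / 3 : ℝ) • u := by
      simp only [LinearMap.add_apply, LinearMap.smul_apply, Module.End.one_apply]
      module
    rw [h]
    exact U.sub_mem (U.smul_mem _ hmem) (U.smul_mem _ hu)
  intro u hu
  have h := hXU _ (hXJU u hu)
  rwa [← Module.End.mul_apply, ← mul_assoc, hXX, one_mul] at h
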